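/- arXiv:2510.25030 — 3 statements merged into one kernel-verified Lean document; each statement's English description precedes it below -/
import Mathlib

section
/- Let n be a positive integer and let (p_{ij}) be an n×n Lorentzian matrix. Then for any indices i, j, k, l, m in {1,…,n} (not necessarily distinct), the pentagonal inequality holds: p_{ij}·p_{ik}·p_{jk}·p_{ll}·p_{lm}·p_{mm} ≤ 4·p_{il}·p_{jl}·p_{kl}·p_{im}·p_{jm}·p_{km}. -/
/-- A Lorentzian matrix: real symmetric with nonnegative entries and at most one
positive eigenvalue (counted with multiplicity). -/
def IsLorentzian {n : ℕ} (M : Matrix (Fin n) (Fin n) ℝ) : Prop :=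
  M.IsSymm ∧ (∀ i j, 0 ≤ M i j) ∧
    ∀ (hM : M.IsHermitian),
      (Finset.univ.filter fun i => 0 < hM.eigenvalues i).card ≤ 1

theorem exists_rotations_of_quadratic_nonneg {R₁ R₂ R₃ C₁₂ C₁₃ C₂₃ : ℝ}
    (h₁ : 0 ≤ R₁) (h₂ : 0 ≤ R₂) (h₃ : 0 ≤ R₃)
    (h : ∀ p q r : ℝ, 0 ≤ R₁ ^ 2 * p ^ 2 + R₂ ^ 2 * q ^ 2 + R₃ ^ 2 * r ^ 2
      + 2 * C₁₂ * p * q + 2 * C₁₃ * p * r + 2 * C₂₃ * q * r) :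
    ∃ c₂ s₂ c₃ s₃ : ℝ, c₂ ^ 2 + s₂ ^ 2 = 1 ∧ c₃ ^ 2 + s₃ ^ 2 = 1 ∧
      R₁ * R₂ * c₂ ≤ C₁₂ ∧ R₁ * R₃ * c₃ ≤ C₁₃ ∧ R₂ * R₃ * (c₂ * c₃ - s₂ * s₃) ≤ C₂₃ := by
  have key : ∀ {R S C : ℝ}, 0 ≤ R → 0 ≤ S →
      (∀ p q : ℝ, 0 ≤ R ^ 2 * p ^ 2 + S ^ 2 * q ^ 2 + 2 * C * p * q) →
      ∃ c : ℝ, C = R * S * c ∧ c ^ 2 ≤ 1 := by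
    intro R S C hR hS hC
    have hd : C ^ 2 ≤ (R * S) ^ 2 := by
      have := discrim_le_zero (a := R ^ 2) (b := 2 * C) (c := S ^ 2)
        (fun x => by linarith [hC x 1])
      rw [discrim] at this
      nlinarith
    rcases (mul_nonneg hR hS).eq_or_lt with h0 | h0
    · rw [← h0] at hd
      exact ⟨0, by nlinarith, by norm_num⟩
    · refine ⟨C / (R * S), (mul_div_cancel₀ C h0.ne').symm, ?_⟩
      rw [div_pow]
      exact div_le_one_of_le₀ hd (sq_nonneg _)
  obtain ⟨c₂, e₂, hc₂⟩ := key h₁ h₂ (C := C₁₂) fun p q => by linarith [h p q 0]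
  obtain ⟨c₃, e₃, hc₃⟩ := key h₁ h₃ (C := C₁₃) fun p q => by linarith [h p 0 q]
  obtain ⟨c, e, hc⟩ := key h₂ h₃ (C := C₂₃) fun p q => by linarith [h 0 p q]
  have hRR := mul_nonneg h₂ h₃
  rcases h₁.eq_or_lt with h0 | h1
  · refine ⟨0, 1, 0, 1, by norm_num, by norm_num, ?_, ?_, ?_⟩
    · rw [e₂, ← h0]; simp
    · rw [e₃, ← h0]; simp
    · rw [e]
      apply mul_le_mul_of_nonneg_left _ hRR
      nlinarith
  have q₂ : c₂ ^ 2 + √(1 - c₂ ^ 2) ^ 2 = 1 := by rw [Real.sq_sqrt (by linarith)]; ring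
  have q₃ : c₃ ^ 2 + √(1 - c₃ ^ 2) ^ 2 = 1 := by rw [Real.sq_sqrt (by linarith)]; ring
  have p₂ := Real.sqrt_nonneg (1 - c₂ ^ 2)
  have p₃ := Real.sqrt_nonneg (1 - c₃ ^ 2)
  generalize √(1 - c₂ ^ 2) = s₂ at *
  generalize √(1 - c₃ ^ 2) = s₃ at *
  refine ⟨c₂, s₂, c₃, s₃, q₂, q₃, e₂.ge, e₃.ge, ?_⟩
  rw [e]
  rcases hRR.eq_or_lt with h0 | h0
  · rw [← h0]; simp
  have hR₂ : R₂ ≠ 0 := fun h => by simp [h] at h0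
  have hR₃ : R₃ ≠ 0 := fun h => by simp [h] at h0
  apply mul_le_mul_of_nonneg_left _ hRR
  have hq : ∀ x : ℝ, 0 ≤ s₂ ^ 2 * (x * x) + 2 * (c - c₂ * c₃) * x + s₃ ^ 2 := by
    intro x
    have := h (-(c₂ * x + c₃) / R₁) (x / R₂) (1 / R₃)
    rw [e, e₂, e₃] at this
    field_simp at this
    linear_combination this - x ^ 2 * q₂ - q₃
  have hd := discrim_le_zero hq
  rw [discrim] at hd
  have := abs_le_of_sq_le_sq (a := c - c₂ * c₃) (b := s₂ * s₃) (by nlinarith) (by positivity)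
  linarith [neg_le_of_abs_le this]

theorem Complex.normSq_det_three_le (a b c : Fin 3 → ℂ) :
    normSq (a 0 * (b 1 * c 2 - b 2 * c 1) + a 1 * (b 2 * c 0 - b 0 * c 2)
        + a 2 * (b 0 * c 1 - b 1 * c 0)) ≤
      (normSq (a 0) + normSq (a 1) + normSq (a 2)) * (normSq (b 0) + normSq (b 1) + normSq (b 2))
        * (normSq (c 0) + normSq (c 1) + normSq (c 2)) := by
  have cs : ∀ x y z x' y' z' : ℂ, normSq (x * x' + y * y' + z * z') ≤
      (normSq x + normSq y + normSq z) * (normSq x' + normSq y' + normSq z') := by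
    intro x y z x' y' z'
    have : (normSq x + normSq y + normSq z) * (normSq x' + normSq y' + normSq z')
        - normSq (x * x' + y * y' + z * z')
        = normSq (x * (starRingEnd ℂ) y' - y * (starRingEnd ℂ) x')
        + normSq (x * (starRingEnd ℂ) z' - z * (starRingEnd ℂ) x')
        + normSq (y * (starRingEnd ℂ) z' - z * (starRingEnd ℂ) y') := by
      simp only [normSq_apply, mul_re, mul_im, add_re, add_im, sub_re, sub_im, conj_re, conj_im]
      ring
    linarith [normSq_nonneg (x * (starRingEnd ℂ) y' - y * (starRingEnd ℂ) x'),
      normSq_nonneg (x * (starRingEnd ℂ) z' - z * (starRingEnd ℂ) x'),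
      normSq_nonneg (y * (starRingEnd ℂ) z' - z * (starRingEnd ℂ) y')]
  have cross : normSq (b 1 * c 2 - b 2 * c 1) + normSq (b 2 * c 0 - b 0 * c 2)
      + normSq (b 0 * c 1 - b 1 * c 0) ≤
      (normSq (b 0) + normSq (b 1) + normSq (b 2))
        * (normSq (c 0) + normSq (c 1) + normSq (c 2)) := by
    have : (normSq (b 0) + normSq (b 1) + normSq (b 2))
        * (normSq (c 0) + normSq (c 1) + normSq (c 2))
        - (normSq (b 1 * c 2 - b 2 * c 1) + normSq (b 2 * c 0 - b 0 * c 2)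
          + normSq (b 0 * c 1 - b 1 * c 0))
        = normSq (b 0 * (starRingEnd ℂ) (c 0) + b 1 * (starRingEnd ℂ) (c 1)
          + b 2 * (starRingEnd ℂ) (c 2)) := by
      simp only [normSq_apply, mul_re, mul_im, add_re, add_im, sub_re, sub_im, conj_re, conj_im]
      ring
    linarith [normSq_nonneg (b 0 * (starRingEnd ℂ) (c 0) + b 1 * (starRingEnd ℂ) (c 1)
          + b 2 * (starRingEnd ℂ) (c 2))]
  rw [mul_assoc (normSq (a 0) + normSq (a 1) + normSq (a 2))]
  refine (cs _ _ _ _ _ _).trans (mul_le_mul_of_nonneg_left cross ?_)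
  linarith [normSq_nonneg (a 0), normSq_nonneg (a 1), normSq_nonneg (a 2)]

theorem Complex.weighted_vandermonde_le {α β γ : ℝ} (hα : 0 ≤ α) (hβ : 0 ≤ β) (hγ : 0 ≤ γ)
    (f₁ f₂ f₃ g₁ g₂ g₃ : ℂ) :
    α * β * γ * (normSq (f₁ * g₂ - f₂ * g₁) * normSq (f₁ * g₃ - f₃ * g₁)
        * normSq (f₂ * g₃ - f₃ * g₂)) ≤
      (α * normSq g₁ ^ 2 + β * (normSq f₁ * normSq g₁) + γ * normSq f₁ ^ 2)
      * (α * normSq g₂ ^ 2 + β * (normSq f₂ * normSq g₂) + γ * normSq f₂ ^ 2)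
      * (α * normSq g₃ ^ 2 + β * (normSq f₃ * normSq g₃) + γ * normSq f₃ ^ 2) := by
  have h := normSq_det_three_le ![√α * g₁ ^ 2, √β * (f₁ * g₁), √γ * f₁ ^ 2]
    ![√α * g₂ ^ 2, √β * (f₂ * g₂), √γ * f₂ ^ 2] ![√α * g₃ ^ 2, √β * (f₃ * g₃), √γ * f₃ ^ 2]
  simp only [Matrix.cons_val, map_mul, map_pow, normSq_ofReal, Real.mul_self_sqrt hα,
    Real.mul_self_sqrt hβ, Real.mul_self_sqrt hγ] at h
  refine le_of_eq_of_le ?_ h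
  rw [← Real.mul_self_sqrt hα, ← Real.mul_self_sqrt hβ, ← Real.mul_self_sqrt hγ]
  simp only [Real.sqrt_mul_self (Real.sqrt_nonneg _)]
  simp only [← normSq_ofReal, ← map_mul]
  rw [← normSq_neg]
  congr 1
  ring

theorem pentagonal_of_quadratic_nonneg {a b c xi xj xk yi yj yk pii pjj pkk pij pik pjk : ℝ}
    (ha : 0 < a) (hb : 0 < b) (hc : 0 < c) (hD : a * c < b ^ 2)
    (hxi : 0 ≤ xi) (hxj : 0 ≤ xj) (hxk : 0 ≤ xk)
    (hii : 0 ≤ pii) (hjj : 0 ≤ pjj) (hkk : 0 ≤ pkk)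
    (hij : 0 ≤ pij) (hik : 0 ≤ pik) (hjk : 0 ≤ pjk)
    (h : ∀ p q r s : ℝ, a * (pii * p ^ 2 + pjj * q ^ 2 + pkk * r ^ 2 + c * s ^ 2
      + 2 * pij * p * q + 2 * pik * p * r + 2 * pjk * q * r
      + 2 * (yi * p + yj * q + yk * r) * s) ≤ (xi * p + xj * q + xk * r + b * s) ^ 2) :
    pij * pik * pjk * a * b * c ≤ 4 * (xi * xj * xk * yi * yj * yk) := by
  obtain ⟨d, hd, hdD⟩ : ∃ d : ℝ, 0 < d ∧ d ^ 2 = b ^ 2 - a * c :=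
    ⟨√(b ^ 2 - a * c), Real.sqrt_pos.2 (by linarith), Real.sq_sqrt (by linarith)⟩
  obtain rfl : c = (b ^ 2 - d ^ 2) / a := by field_simp; linarith
  obtain ⟨σ, hσ⟩ : ∃ σ, σ = (b + d) / a := ⟨_, rfl⟩
  have hσ0 : 0 < σ := by rw [hσ]; positivity
  obtain rfl : b = a * σ - d := by rw [hσ]; field_simp; ring
  obtain ⟨τ, hτ⟩ : ∃ τ, τ = (a * σ - 2 * d) / 2 := ⟨_, rfl⟩
  have hcc : ((a * σ - d) ^ 2 - d ^ 2) / a = 2 * σ * τ := by rw [hτ]; field_simp; ring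
  rw [hcc] at hc h hD hdD ⊢
  have hτ0 : 0 < τ := by
    by_contra hn
    nlinarith [mul_nonneg hσ0.le (by linarith : 0 ≤ -τ)]
  -- coordinates with respect to an isotropic basis of the plane spanned by `l` and `m`
  have coord : ∀ x y : ℝ, ∃ u v : ℝ, x = v + a / 2 * u ∧ y = σ * v + τ * u := fun x y =>
    ⟨(σ * x - y) / d, x - a / 2 * ((σ * x - y) / d), by ring, by rw [hτ]; field_simp; ring⟩
  obtain ⟨ui, vi, rfl, rfl⟩ := coord xi yi
  obtain ⟨uj, vj, rfl, rfl⟩ := coord xj yj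
  obtain ⟨uk, vk, rfl, rfl⟩ := coord xk yk
  have psd : ∀ p q r : ℝ, pii * p ^ 2 + pjj * q ^ 2 + pkk * r ^ 2
      + 2 * pij * p * q + 2 * pik * p * r + 2 * pjk * q * r ≤
      2 * (ui * p + uj * q + uk * r) * (vi * p + vj * q + vk * r) := by
    intro p q r
    set U := ui * p + uj * q + uk * r with hU
    set V := vi * p + vj * q + vk * r with hV
    have h1 := h p q r ((V - a * U / 2) / d)
    have e1 : (vi + a / 2 * ui) * p + (vj + a / 2 * uj) * q + (vk + a / 2 * uk) * r
        = V + a / 2 * U := by rw [hU, hV]; ring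
    have e2 : (σ * vi + τ * ui) * p + (σ * vj + τ * uj) * q + (σ * vk + τ * uk) * r
        = σ * V + τ * U := by rw [hU, hV]; ring
    rw [e1, e2] at h1
    refine le_of_mul_le_mul_left ?_ ha
    clear_value U V
    obtain ⟨s, rfl⟩ : ∃ s, V = d * s + a * U / 2 := ⟨(V - a * U / 2) / d, by field_simp; ring⟩
    rw [show (d * s + a * U / 2 - a * U / 2) / d = s by field_simp; ring, hτ] at h1
    linear_combination h1
  have uv : ∀ {p u v : ℝ}, 0 ≤ p → p ≤ 2 * (u * v) → 0 ≤ v + a / 2 * u → 0 ≤ u ∧ 0 ≤ v := by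
    intro p u v hp h1 h2
    have h3 : 0 ≤ u * v := by linarith
    constructor
    · by_contra! hn
      nlinarith [mul_pos ha (neg_pos.2 hn)]
    · by_contra! hn
      nlinarith [mul_pos ha (neg_pos.2 hn)]
  have hi' : pii ≤ 2 * (ui * vi) := by linarith [psd 1 0 0]
  have hj' : pjj ≤ 2 * (uj * vj) := by linarith [psd 0 1 0]
  have hk' : pkk ≤ 2 * (uk * vk) := by linarith [psd 0 0 1]
  obtain ⟨hui, hvi⟩ := uv hii hi' hxi
  obtain ⟨huj, hvj⟩ := uv hjj hj' hxj
  obtain ⟨huk, hvk⟩ := uv hkk hk' hxk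
  clear h coord uv
  obtain ⟨ei, hei, rfl⟩ : ∃ e : ℝ, 0 ≤ e ∧ e ^ 2 = ui := ⟨√ui, by positivity, Real.sq_sqrt hui⟩
  obtain ⟨ej, hej, rfl⟩ : ∃ e : ℝ, 0 ≤ e ∧ e ^ 2 = uj := ⟨√uj, by positivity, Real.sq_sqrt huj⟩
  obtain ⟨ek, hek, rfl⟩ : ∃ e : ℝ, 0 ≤ e ∧ e ^ 2 = uk := ⟨√uk, by positivity, Real.sq_sqrt huk⟩
  obtain ⟨gi, hgi, rfl⟩ : ∃ e : ℝ, 0 ≤ e ∧ e ^ 2 = vi := ⟨√vi, by positivity, Real.sq_sqrt hvi⟩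
  obtain ⟨gj, hgj, rfl⟩ : ∃ e : ℝ, 0 ≤ e ∧ e ^ 2 = vj := ⟨√vj, by positivity, Real.sq_sqrt hvj⟩
  obtain ⟨gk, hgk, rfl⟩ : ∃ e : ℝ, 0 ≤ e ∧ e ^ 2 = vk := ⟨√vk, by positivity, Real.sq_sqrt hvk⟩
  obtain ⟨cj, sj, ck, sk, qj, qk, bij, bik, bjk⟩ := exists_rotations_of_quadratic_nonneg
    (R₁ := ei * gi) (R₂ := ej * gj) (R₃ := ek * gk)
    (C₁₂ := (ei ^ 2 * gj ^ 2 + ej ^ 2 * gi ^ 2 - pij) / 2)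
    (C₁₃ := (ei ^ 2 * gk ^ 2 + ek ^ 2 * gi ^ 2 - pik) / 2)
    (C₂₃ := (ej ^ 2 * gk ^ 2 + ek ^ 2 * gj ^ 2 - pjk) / 2)
    (by positivity) (by positivity) (by positivity) (fun p q r => by
      linear_combination (psd p q r + mul_nonneg hii (sq_nonneg p)
        + mul_nonneg hjj (sq_nonneg q) + mul_nonneg hkk (sq_nonneg r)) / 2)
  have hV := Complex.weighted_vandermonde_le (α := σ) (β := a * σ - d) (γ := a * τ / 2)
    hσ0.le hb.le (by positivity) ei ⟨ej * cj, ej * sj⟩ ⟨ek * ck, -(ek * sk)⟩ gi gj gk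
  have nj : Complex.normSq ⟨ej * cj, ej * sj⟩ = ej ^ 2 := by
    rw [Complex.normSq_mk]; linear_combination ej ^ 2 * qj
  have nk : Complex.normSq ⟨ek * ck, -(ek * sk)⟩ = ek ^ 2 := by
    rw [Complex.normSq_mk]; linear_combination ek ^ 2 * qk
  rw [nj, nk] at hV
  simp only [Complex.normSq_ofReal] at hV
  have nij : pij ≤ Complex.normSq (ei * gj - ⟨ej * cj, ej * sj⟩ * gi) := by
    simp [Complex.normSq_apply]
    linear_combination 2 * bij - ej ^ 2 * gi ^ 2 * qj
  have nik : pik ≤ Complex.normSq (ei * gk - ⟨ek * ck, -(ek * sk)⟩ * gi) := by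
    simp [Complex.normSq_apply]
    linear_combination 2 * bik - ek ^ 2 * gi ^ 2 * qk
  have njk : pjk ≤ Complex.normSq (⟨ej * cj, ej * sj⟩ * gk - ⟨ek * ck, -(ek * sk)⟩ * gj) := by
    simp [Complex.normSq_apply]
    linear_combination 2 * bjk - ek ^ 2 * gj ^ 2 * qk - ej ^ 2 * gk ^ 2 * qj
  have hprod := mul_le_mul (mul_le_mul nij nik hik (hij.trans nij)) njk hjk
    (mul_nonneg (hij.trans nij) (hik.trans nik))
  have hw : 0 ≤ σ * (a * σ - d) * (a * τ / 2) := by positivity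
  have := (mul_le_mul_of_nonneg_left hprod hw).trans hV
  rw [hτ] at this ⊢
  linarith

open Matrix in
theorem Matrix.IsHermitian.dotProduct_mulVec_eq_sum {n : Type*} [Fintype n] [DecidableEq n]
    {M : Matrix n n ℝ} (hM : M.IsHermitian) (x : n → ℝ) :
    x ⬝ᵥ M *ᵥ x = ∑ i, hM.eigenvalues i * ((hM.eigenvectorUnitary : Matrix n n ℝ)ᵀ *ᵥ x) i ^ 2 := by
  conv_lhs => rw [hM.spectral_theorem]
  rw [Unitary.conjStarAlgAut_apply, ← mulVec_mulVec, ← mulVec_mulVec, dotProduct_mulVec,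
    ← mulVec_transpose, dotProduct]
  refine Finset.sum_congr rfl fun i _ => ?_
  rw [mulVec_diagonal]
  simp only [star_eq_conjTranspose, conjTranspose_eq_transpose_of_trivial]
  simp
  ring

open Matrix in
theorem IsLorentzian.mul_dotProduct_mulVec_le {n : ℕ} {M : Matrix (Fin n) (Fin n) ℝ}
    (hM : IsLorentzian M) {x : Fin n → ℝ} (hx : 0 < x ⬝ᵥ M *ᵥ x) (y : Fin n → ℝ) :
    (x ⬝ᵥ M *ᵥ x) * (y ⬝ᵥ M *ᵥ y) ≤ (x ⬝ᵥ M *ᵥ y) ^ 2 := by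
  obtain ⟨hsymm, -, hcard⟩ := hM
  have hH : M.IsHermitian := by
    rwa [IsHermitian, conjTranspose_eq_transpose_of_trivial]
  specialize hcard hH
  obtain ⟨i, hi, hxi⟩ : ∃ i, 0 < hH.eigenvalues i ∧
      ((hH.eigenvectorUnitary : Matrix _ _ ℝ)ᵀ *ᵥ x) i ≠ 0 := by
    by_contra! hn
    refine hx.not_ge ?_
    rw [hH.dotProduct_mulVec_eq_sum]
    refine Finset.sum_nonpos fun j _ => ?_
    rcases lt_or_ge 0 (hH.eigenvalues j) with hj | hj
    · simp [hn j hj]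
    · exact mul_nonpos_of_nonpos_of_nonneg hj (sq_nonneg _)
  obtain ⟨s, hs⟩ : ∃ s : ℝ, ((hH.eigenvectorUnitary : Matrix _ _ ℝ)ᵀ *ᵥ (y - s • x)) i = 0 :=
    ⟨((hH.eigenvectorUnitary : Matrix _ _ ℝ)ᵀ *ᵥ y) i /
      ((hH.eigenvectorUnitary : Matrix _ _ ℝ)ᵀ *ᵥ x) i, by
        simp only [mulVec_sub, mulVec_smul, Pi.sub_apply, Pi.smul_apply, smul_eq_mul]
        field_simp
        ring⟩
  have hneg : (y - s • x) ⬝ᵥ M *ᵥ (y - s • x) ≤ 0 := by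
    rw [hH.dotProduct_mulVec_eq_sum]
    refine Finset.sum_nonpos fun j _ => ?_
    rcases eq_or_ne j i with rfl | hji
    · simp [hs]
    · refine mul_nonpos_of_nonpos_of_nonneg (le_of_not_gt fun hj => hji ?_) (sq_nonneg _)
      exact Finset.card_le_one.1 hcard j (by simpa) i (by simpa)
  have hyx : y ⬝ᵥ M *ᵥ x = x ⬝ᵥ M *ᵥ y := by
    rw [dotProduct_mulVec, ← mulVec_transpose, hsymm.eq, dotProduct_comm]
  simp only [mulVec_sub, mulVec_smul, dotProduct_sub, sub_dotProduct, dotProduct_smul,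
    smul_dotProduct, smul_eq_mul, hyx] at hneg
  nlinarith [sq_nonneg (x ⬝ᵥ M *ᵥ y - s * (x ⬝ᵥ M *ᵥ x))]

theorem pentagonal_inequality (n : ℕ) (hn : 0 < n) (M : Matrix (Fin n) (Fin n) ℝ)
    (hM : IsLorentzian M) (i j k l m : Fin n) :
    M i j * M i k * M j k * M l l * M l m * M m m ≤
      4 * (M i l * M j l * M k l * M i m * M j m * M k m) := by
  have hpos := hM.2.1
  have hrhs : 0 ≤ 4 * (M i l * M j l * M k l * M i m * M j m * M k m) := by
    have := hpos i l; have := hpos j l; have := hpos k l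
    have := hpos i m; have := hpos j m; have := hpos k m
    positivity
  rcases (hpos l l).eq_or_lt with ha | ha
  · simpa [← ha] using hrhs
  rcases (hpos m m).eq_or_lt with hc | hc
  · simpa [← hc] using hrhs
  have symm : ∀ r s, M r s = M s r := fun r s => hM.1.apply s r
  have cs : ∀ p q r s : ℝ, M l l * (M i i * p ^ 2 + M j j * q ^ 2 + M k k * r ^ 2 + M m m * s ^ 2
      + 2 * M i j * p * q + 2 * M i k * p * r + 2 * M j k * q * r
      + 2 * (M i m * p + M j m * q + M k m * r) * s) ≤
      (M i l * p + M j l * q + M k l * r + M l m * s) ^ 2 := by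
    intro p q r s
    have h := hM.mul_dotProduct_mulVec_le (x := Pi.single l 1) (by simpa using ha)
      (p • Pi.single i 1 + q • Pi.single j 1 + r • Pi.single k 1 + s • Pi.single m 1)
    simp only [Matrix.mulVec_add, Matrix.mulVec_smul, Matrix.mulVec_single_one, dotProduct_add,
      add_dotProduct, dotProduct_smul, smul_dotProduct, single_one_dotProduct, smul_eq_mul,
      Matrix.col_apply] at h
    rw [symm j i, symm k i, symm m i, symm k j, symm m j, symm m k, symm l i, symm l j,
      symm l k] at h
    linarith
  have hbc : M l l * M m m ≤ M l m ^ 2 := by linarith [cs 0 0 0 1]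
  have hb : 0 < M l m := (hpos l m).lt_of_ne fun h => by
    rw [← h] at hbc
    nlinarith [mul_pos ha hc]
  -- the case of a degenerate plane follows by continuity in `M m m`
  have main : ∀ c ∈ Set.Ioo 0 (M m m), M i j * M i k * M j k * M l l * M l m * c ≤
      4 * (M i l * M j l * M k l * M i m * M j m * M k m) := fun c hcm =>
    pentagonal_of_quadratic_nonneg ha hb hcm.1
      ((mul_lt_mul_of_pos_left hcm.2 ha).trans_le hbc) (hpos i l) (hpos j l) (hpos k l)
      (hpos i i) (hpos j j) (hpos k k) (hpos i j) (hpos i k) (hpos j k) fun p q r s => by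
        refine le_trans ?_ (cs p q r s)
        gcongr
        exact hcm.2.le
  exact le_on_closure (x := M m m) main (by fun_prop) continuousOn_const
    (by rw [closure_Ioo hc.ne]; exact ⟨hc.le, le_rfl⟩)
end

section
/- Let (p_{ij}) be an n×n real symmetric matrix with nonnegative entries such that for all indices i, j, k, l in {1,…,n}, the maximum among the three products p_{ij}·p_{kl}, p_{ik}·p_{jl}, p_{il}·p_{jk} is attained at least twice. Then (p_{ij}) has at most one positive eigenvalue (counted with multiplicity); that is, (p_{ij}) is a Lorentzian matrix. -/
open Finset in
/-- The indicator of a symmetric transitive relation on a finite set is a positive semidefinite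
kernel. -/
theorem sum_mul_ite_nonneg_of_symm_trans {ι : Type*} (s : Finset ι) (r : ι → ι → Prop)
    [DecidableRel r] (hs : ∀ i ∈ s, ∀ j ∈ s, r i j → r j i)
    (ht : ∀ i ∈ s, ∀ j ∈ s, ∀ k ∈ s, r i j → r j k → r i k) (y : ι → ℝ) :
    0 ≤ ∑ i ∈ s, ∑ j ∈ s, y i * y j * (if r i j then 1 else 0) := by
  classical
  let c : ι → Finset ι := fun i => s.filter (r i)
  let z : ι → ℝ := fun i => if r i i then y i else 0
  have hc : ∀ i ∈ s, ∀ j ∈ s, y i * y j * (if r i j then 1 else 0)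
      = ∑ d ∈ s.powerset, (if c i = d then z i else 0) * (if c j = d then z j else 0) := by
    intro i hi j hj
    have hci : c i ∈ s.powerset := by simp [c]
    have h1 : ∀ d ∈ s.powerset, (if c i = d then z i else 0) * (if c j = d then z j else 0)
        = if c i = d then z i * (if c j = c i then z j else 0) else 0 := by
      intro d _
      by_cases h : c i = d
      · subst h; simp
      · simp [h]
    rw [sum_congr rfl h1, sum_ite_eq, if_pos hci]
    by_cases hij : r i j
    · have hji := hs i hi j hj hij
      have hii := ht i hi j hj i hi hij hji
      have hjj := ht j hj i hi j hj hji hij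
      have hcc : c j = c i := by
        ext k
        simp only [c, mem_filter]
        constructor
        · rintro ⟨hk, h⟩
          exact ⟨hk, ht i hi j hj k hk hij h⟩
        · rintro ⟨hk, h⟩
          exact ⟨hk, ht j hj i hi k hk hji h⟩
      simp [hij, hcc, z, hii, hjj]
    · by_cases hjj : r j j
      · have hcc : c j ≠ c i := by
          intro h
          have : j ∈ c i := h ▸ (by simp [c, hj, hjj])
          exact hij (by simpa [c, hj] using this)
        simp [hij, hcc]
      · simp [hij, z, hjj]
  have key : ∑ i ∈ s, ∑ j ∈ s, y i * y j * (if r i j then 1 else 0)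
      = ∑ d ∈ s.powerset, (∑ i ∈ s, if c i = d then z i else 0) ^ 2 := by
    rw [sum_congr rfl fun i hi => sum_congr rfl fun j hj => hc i hi j hj,
      sum_congr rfl fun i _ => sum_comm, sum_comm]
    refine sum_congr rfl fun d _ => ?_
    rw [sq, sum_mul_sum]
  rw [key]
  positivity

open Finset MeasureTheory in
/-- Nonnegative kernels satisfying the ultrametric inequality are conditionally negative
semidefinite. -/
theorem sum_mul_nonpos_of_ultrametric {ι : Type*} (s : Finset ι) (a : ι → ι → ℝ)
    (hnn : ∀ i ∈ s, ∀ j ∈ s, 0 ≤ a i j) (hs : ∀ i ∈ s, ∀ j ∈ s, a i j = a j i)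
    (ht : ∀ i ∈ s, ∀ j ∈ s, ∀ k ∈ s, a i k ≤ max (a i j) (a j k))
    (y : ι → ℝ) (hy : ∑ i ∈ s, y i = 0) :
    ∑ i ∈ s, ∑ j ∈ s, y i * y j * a i j ≤ 0 := by
  classical
  let f : ι → ι → ℝ → ℝ := fun i j => (Set.Ico 0 (a i j)).indicator 1
  have hfint : ∀ i j, Integrable (f i j) := fun i j =>
    (integrable_indicator_iff measurableSet_Ico).2
      (integrableOn_const (by simp) : IntegrableOn (fun _ => (1 : ℝ)) _ _)
  have hint : ∀ i ∈ s, ∀ j ∈ s, a i j = ∫ t, f i j t := by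
    intro i hi j hj
    rw [integral_indicator_one measurableSet_Ico, Real.volume_real_Ico_of_le (hnn i hi j hj),
      sub_zero]
  have key : ∑ i ∈ s, ∑ j ∈ s, y i * y j * a i j
      = ∫ t, ∑ i ∈ s, ∑ j ∈ s, y i * y j * f i j t := by
    rw [integral_finsetSum _ fun i _ => integrable_finsetSum _ fun j _ =>
      (hfint i j).const_mul _]
    refine sum_congr rfl fun i hi => ?_
    rw [integral_finsetSum _ fun j _ => (hfint i j).const_mul _]
    refine sum_congr rfl fun j hj => ?_
    rw [integral_const_mul, ← hint i hi j hj]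
  rw [key]
  refine integral_nonpos fun t => ?_
  by_cases h0 : 0 ≤ t
  · have h1 : ∀ i j, y i * y j * f i j t
        = y i * y j - y i * y j * (if a i j ≤ t then 1 else 0) := by
      intro i j
      by_cases h : a i j ≤ t
      · simp [f, h, not_lt.2 h]
      · simp [f, h, not_le.1 h, h0]
    have h2 := sum_mul_ite_nonneg_of_symm_trans s (fun i j => a i j ≤ t)
      (fun i hi j hj h => hs i hi j hj ▸ h)
      (fun i hi j hj k hk h h' => (ht i hi j hj k hk).trans (max_le h h')) y
    simp only [h1, sum_sub_distrib, ← sum_mul_sum, hy, Pi.zero_apply]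
    linarith
  · simp [f, h0]

open Finset in
/-- The quadratic form of a matrix in `Δ_n(T_0)` is nonpositive on the orthogonal complement of
any nonzero row. -/
theorem sum_mul_nonpos_of_row_orthogonal {n : ℕ} (M : Matrix (Fin n) (Fin n) ℝ)
    (hsymm : ∀ i j, M i j = M j i) (hnn : ∀ i j, 0 ≤ M i j)
    (htwice : ∀ i j k l : Fin n,
      (M i j * M k l = M i k * M j l ∧ M i l * M j k ≤ M i j * M k l) ∨
      (M i j * M k l = M i l * M j k ∧ M i k * M j l ≤ M i j * M k l) ∨
      (M i k * M j l = M i l * M j k ∧ M i j * M k l ≤ M i k * M j l))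
    (m k₀ : Fin n) (hk₀ : M m k₀ ≠ 0) (x : Fin n → ℝ) (hx : ∑ j, M m j * x j = 0) :
    ∑ i, ∑ j, x i * x j * M i j ≤ 0 := by
  classical
  have hZ : ∀ i, M m i = 0 → ∀ j, M i j * M m k₀ = M i k₀ * M m j := by
    intro i hi j
    have hi' : M i m = 0 := by rw [hsymm, hi]
    have a1 := mul_nonneg (hnn i j) (hnn m k₀)
    have a2 := mul_nonneg (hnn i k₀) (hnn m j)
    have := htwice i m j k₀
    rw [hi'] at this
    rcases this with h | h | h <;> linarith [h.1, h.2]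
  have hrow : ∀ i, M m i = 0 → ∀ w : Fin n → ℝ, ∑ j, M m j * w j = 0 →
      ∑ j, M i j * w j = 0 := by
    intro i hi w hw
    refine (mul_eq_zero.1 ?_).resolve_right hk₀
    rw [sum_mul, sum_congr rfl fun j _ => show M i j * w j * M m k₀ = M i k₀ * (M m j * w j) by
      linear_combination w j * hZ i hi j, ← mul_sum, hw, mul_zero]
  let s : Finset (Fin n) := univ.filter fun i => M m i ≠ 0
  let x' : Fin n → ℝ := fun i => if M m i ≠ 0 then x i else 0
  have hx' : ∑ j, M m j * x' j = 0 := by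
    rw [← hx]
    refine sum_congr rfl fun j _ => ?_
    by_cases h : M m j = 0 <;> simp [x', h]
  have hswap : ∀ u w : Fin n → ℝ,
      ∑ i, ∑ j, u i * w j * M i j = ∑ i, u i * ∑ j, M i j * w j := by
    intro u w
    refine sum_congr rfl fun i _ => ?_
    rw [mul_sum]
    exact sum_congr rfl fun j _ => by ring
  have hrestrict : ∀ w : Fin n → ℝ, ∑ j, M m j * w j = 0 →
      ∑ i, ∑ j, x i * w j * M i j = ∑ i, ∑ j, x' i * w j * M i j := by
    intro w hw
    rw [hswap, hswap]
    refine sum_congr rfl fun i _ => ?_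
    by_cases h : M m i = 0
    · rw [hrow i h w hw, mul_zero, mul_zero]
    · simp [x', h]
  have hcomm : ∑ i, ∑ j, x' i * x j * M i j = ∑ i, ∑ j, x i * x' j * M i j := by
    rw [sum_comm]
    exact sum_congr rfl fun i _ => sum_congr rfl fun j _ => by rw [hsymm j i]; ring
  have hpos : ∀ i ∈ s, 0 < M m i := fun i hi =>
    lt_of_le_of_ne (hnn m i) (Ne.symm (by simpa [s] using hi))
  rw [hrestrict x hx, hcomm, hrestrict x' hx']
  have hs : ∑ i, ∑ j, x' i * x' j * M i j = ∑ i ∈ s, ∑ j ∈ s,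
      (M m i * x i) * (M m j * x j) * (M i j / (M m i * M m j)) := by
    have : ∀ i j, x' i * x' j * M i j
        = if M m i ≠ 0 then (if M m j ≠ 0 then
          (M m i * x i) * (M m j * x j) * (M i j / (M m i * M m j)) else 0) else 0 := by
      intro i j
      by_cases hi : M m i = 0
      · simp [x', hi]
      by_cases hj : M m j = 0
      · simp [x', hj]
      simp only [x', ne_eq, hi, hj, not_false_eq_true, if_true]
      field_simp
    simp only [s, sum_filter, this]
    refine sum_congr rfl fun i _ => ?_
    by_cases hi : M m i = 0 <;> simp [hi]
  rw [hs]
  refine sum_mul_nonpos_of_ultrametric s (fun i j => M i j / (M m i * M m j)) ?_ ?_ ?_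
    (fun i => M m i * x i) ?_
  · exact fun i _ j _ => div_nonneg (hnn i j) (mul_nonneg (hnn m i) (hnn m j))
  · exact fun i _ j _ => by rw [hsymm i j, mul_comm (M m i)]
  · intro i hi j hj k hk
    have pi := hpos i hi
    have pj := hpos j hj
    have pk := hpos k hk
    rw [le_max_iff, div_le_div_iff₀ (by positivity) (by positivity),
      div_le_div_iff₀ (by positivity) (by positivity)]
    have : M i k * M m j ≤ M i j * M m k ∨ M i k * M m j ≤ M j k * M m i := by
      have := htwice i k m j
      rw [hsymm i m, hsymm k m, hsymm k j] at this
      rcases this with h | h | h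
      · right; linarith [h.1, h.2]
      · left; linarith [h.1, h.2]
      · left; linarith [h.1, h.2]
    rcases this with h | h
    · left; nlinarith [mul_le_mul_of_nonneg_left h pi.le]
    · right; nlinarith [mul_le_mul_of_nonneg_left h pk.le]
  · rw [← hx, sum_filter]
    refine sum_congr rfl fun j _ => ?_
    by_cases h : M m j = 0 <;> simp [h]

open Finset Matrix in
/-- A real symmetric matrix whose quadratic form is nonpositive on a hyperplane has at most one
positive eigenvalue. -/
theorem card_pos_eigenvalues_le_one {n : ℕ} {M : Matrix (Fin n) (Fin n) ℝ}
    (hM : M.IsHermitian) (q : Fin n → ℝ)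
    (h : ∀ x : Fin n → ℝ, q ⬝ᵥ x = 0 → x ⬝ᵥ M *ᵥ x ≤ 0) :
    (univ.filter fun i => 0 < hM.eigenvalues i).card ≤ 1 := by
  refine card_le_one.2 fun i hi j hj => ?_
  simp only [mem_filter, mem_univ, true_and] at hi hj
  by_contra hij
  let e : Fin n → Fin n → ℝ := fun i => hM.eigenvectorBasis i
  have he : ∀ a b, e a ⬝ᵥ e b = if a = b then 1 else 0 := by
    intro a b
    have := (orthonormal_iff_ite.1 hM.eigenvectorBasis.orthonormal) a b
    rw [← this, EuclideanSpace.inner_eq_star_dotProduct, dotProduct_comm]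
    simp [e]
  have hMe : ∀ a, M *ᵥ e a = hM.eigenvalues a • e a := fun a => hM.mulVec_eigenvectorBasis a
  have hform : ∀ α β : ℝ, (α • e i + β • e j) ⬝ᵥ M *ᵥ (α • e i + β • e j)
      = α ^ 2 * hM.eigenvalues i + β ^ 2 * hM.eigenvalues j := by
    intro α β
    simp only [mulVec_add, mulVec_smul, hMe, dotProduct_add, add_dotProduct, smul_dotProduct,
      dotProduct_smul, he, smul_eq_mul, if_true, if_neg hij, if_neg (Ne.symm hij)]
    ring
  have hle : ∀ α β : ℝ, α * (q ⬝ᵥ e i) + β * (q ⬝ᵥ e j) = 0 →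
      α ^ 2 * hM.eigenvalues i + β ^ 2 * hM.eigenvalues j ≤ 0 := by
    intro α β hαβ
    rw [← hform]
    exact h _ (by simpa [dotProduct_add, dotProduct_smul] using hαβ)
  by_cases hqi : q ⬝ᵥ e i = 0
  · have := hle 1 0 (by simp [hqi])
    linarith
  · have := hle (q ⬝ᵥ e j) (-(q ⬝ᵥ e i)) (by ring)
    have h1 : 0 < (-(q ⬝ᵥ e i)) ^ 2 := sq_pos_of_ne_zero (neg_ne_zero.2 hqi)
    have h2 := mul_pos h1 hj
    have h3 := mul_nonneg (sq_nonneg (q ⬝ᵥ e j)) hi.le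
    linarith

theorem T0_implies_Lorentzian (n : ℕ) (M : Matrix (Fin n) (Fin n) ℝ)
    (hsymm : M.IsSymm) (hnn : ∀ i j, 0 ≤ M i j)
    (htwice : ∀ i j k l : Fin n,
      (M i j * M k l = M i k * M j l ∧ M i l * M j k ≤ M i j * M k l) ∨
      (M i j * M k l = M i l * M j k ∧ M i k * M j l ≤ M i j * M k l) ∨
      (M i k * M j l = M i l * M j k ∧ M i j * M k l ≤ M i k * M j l)) :
    IsLorentzian M := by
  refine ⟨hsymm, hnn, fun hM => ?_⟩
  by_cases h0 : ∃ m k, M m k ≠ 0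
  · obtain ⟨m, k, hmk⟩ := h0
    refine card_pos_eigenvalues_le_one hM (M m) fun x hx => ?_
    have := sum_mul_nonpos_of_row_orthogonal M (fun i j => hsymm.apply j i) hnn htwice m k hmk x hx
    convert this using 1
    simp only [dotProduct, Matrix.mulVec, Finset.mul_sum]
    exact Finset.sum_congr rfl fun i _ => Finset.sum_congr rfl fun j _ => by ring
  · push Not at h0
    refine card_pos_eigenvalues_le_one hM 0 fun x _ => ?_
    simp [show M = 0 from Matrix.ext h0]
end

section
/- Let n be a positive integer and let α = (α_{ij})_{1≤i<j≤n} be a vector of real numbers. Then there exists a constant c > 0 such that ∏_{1≤i<j≤n} p_{ij}^{α_{ij}} ≤ c for every normalized Lorentzian matrix (p_{ij}) with all entries positive if and only if there exists a constant c' > 0 such that ∏_{1≤i<j≤n} p_{ij}^{α_{ij}} ≤ c' for every normalized Lorentzian matrix of rank at most 2 with all entries positive. In other words, the cone of reduced bounded ratios on positive Lorentzian matrices equals the cone of reduced bounded ratios on positive Lorentzian matrices of rank at most 2. -/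
/-- The finset of ordered pairs (i, j) with i < j, indexing the off-diagonal
entries of a symmetric matrix. -/
def offDiagPairs (n : ℕ) : Finset (Fin n × Fin n) :=
  Finset.univ.filter fun q => q.1 < q.2

open Matrix

theorem Matrix.IsHermitian.dotProduct_mulVec_eq_sum_eigenvalues {n : ℕ}
    {M : Matrix (Fin n) (Fin n) ℝ} (hM : M.IsHermitian) (v : Fin n → ℝ) :
    v ⬝ᵥ M *ᵥ v = ∑ k, hM.eigenvalues k *
      ((star (hM.eigenvectorUnitary : Matrix (Fin n) (Fin n) ℝ)) *ᵥ v) k ^ 2 := by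
  conv_lhs => rw [hM.spectral_theorem, Unitary.conjStarAlgAut_apply]
  rw [← mulVec_mulVec, ← mulVec_mulVec, dotProduct_mulVec, ← mulVec_transpose,
    ← conjTranspose_eq_transpose_of_trivial, ← star_eq_conjTranspose]
  simp only [dotProduct, mulVec_diagonal]
  refine Finset.sum_congr rfl fun k _ => ?_
  simp only [Function.comp_apply, RCLike.ofReal_real_eq_id, id]
  ring

/-- A Hermitian real matrix has at most one positive eigenvalue iff its quadratic form is
nonpositive on some hyperplane. -/
theorem Matrix.IsHermitian.card_pos_eigenvalues_le_one_iff {n : ℕ}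
    {M : Matrix (Fin n) (Fin n) ℝ} (hM : M.IsHermitian) :
    (Finset.univ.filter fun i => 0 < hM.eigenvalues i).card ≤ 1 ↔
      ∃ φ : (Fin n → ℝ) →ₗ[ℝ] ℝ, ∀ v, φ v = 0 → v ⬝ᵥ M *ᵥ v ≤ 0 := by
  set U : Matrix (Fin n) (Fin n) ℝ := (hM.eigenvectorUnitary : Matrix (Fin n) (Fin n) ℝ) with hU
  constructor
  · intro h
    by_cases hpos : ∃ i, 0 < hM.eigenvalues i
    · obtain ⟨i, hi⟩ := hpos
      refine ⟨LinearMap.proj i ∘ₗ (star U).mulVecLin, fun v hv => ?_⟩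
      rw [hM.dotProduct_mulVec_eq_sum_eigenvalues]
      refine Finset.sum_nonpos fun k _ => ?_
      by_cases hk : k = i
      · subst hk
        have hv' : (star U *ᵥ v) k = 0 := by simpa using hv
        rw [← hU, hv']
        simp
      · refine mul_nonpos_of_nonpos_of_nonneg (not_lt.1 fun hk' => hk ?_) (sq_nonneg _)
        exact Finset.card_le_one.1 h k (by simpa using hk') i (by simpa using hi)
    · push Not at hpos
      refine ⟨0, fun v _ => ?_⟩
      rw [hM.dotProduct_mulVec_eq_sum_eigenvalues]
      exact Finset.sum_nonpos fun k _ =>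
        mul_nonpos_of_nonpos_of_nonneg (hpos k) (sq_nonneg _)
  · rintro ⟨φ, hφ⟩
    refine Finset.card_le_one.2 fun i hi j hj => ?_
    by_contra hij
    simp only [Finset.mem_filter, Finset.mem_univ, true_and] at hi hj
    set ψ : (Fin n → ℝ) →ₗ[ℝ] ℝ := φ ∘ₗ U.mulVecLin with hψ
    obtain ⟨a, b, hab, hzero⟩ : ∃ a b : ℝ, (a ≠ 0 ∨ b ≠ 0) ∧
        ψ (Pi.single i a + Pi.single j b) = 0 := by
      have hs : ∀ (k : Fin n) (c : ℝ), ψ (Pi.single k c) = c * ψ (Pi.single k 1) := by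
        intro k c
        rw [← smul_eq_mul, ← map_smul, ← Pi.single_smul]
        simp
      by_cases h1 : ψ (Pi.single i 1) = 0
      · exact ⟨1, 0, Or.inl one_ne_zero, by simp [h1]⟩
      · refine ⟨ψ (Pi.single j 1), -ψ (Pi.single i 1), Or.inr (neg_ne_zero.2 h1), ?_⟩
        rw [map_add, hs i (ψ (Pi.single j 1)), hs j (-ψ (Pi.single i 1))]
        ring
    set w : Fin n → ℝ := Pi.single i a + Pi.single j b with hw
    have hle := hφ (U *ᵥ w) (by simpa [hψ] using hzero)
    have hUU : star U *ᵥ (U *ᵥ w) = w := by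
      rw [mulVec_mulVec, hU, Unitary.coe_star_mul_self, one_mulVec]
    rw [hM.dotProduct_mulVec_eq_sum_eigenvalues, ← hU, hUU,
      Finset.sum_eq_add i j hij (fun k _ hk => by simp [hw, hk.1, hk.2]) (by simp) (by simp)] at hle
    have hwi : w i = a := by simp [hw, hij]
    have hwj : w j = b := by simp [hw, Ne.symm hij]
    rw [hwi, hwj] at hle
    have h1 := mul_nonneg hi.le (sq_nonneg a)
    have h2 := mul_nonneg hj.le (sq_nonneg b)
    rcases hab with h | h
    · have := mul_pos hi (pow_pos (abs_pos.2 h) 2)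
      rw [sq_abs] at this
      linarith
    · have := mul_pos hj (pow_pos (abs_pos.2 h) 2)
      rw [sq_abs] at this
      linarith

/-- The reversed Cauchy–Schwarz inequality for Lorentzian matrices. -/
theorem IsLorentzian.mul_le_sq {n : ℕ} {M : Matrix (Fin n) (Fin n) ℝ} (hM : IsLorentzian M)
    {x y : Fin n → ℝ} (hx : 0 < x ⬝ᵥ M *ᵥ x) :
    (x ⬝ᵥ M *ᵥ x) * (y ⬝ᵥ M *ᵥ y) ≤ (x ⬝ᵥ M *ᵥ y) ^ 2 := by
  have hH : M.IsHermitian := by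
    rw [IsHermitian, conjTranspose_eq_transpose_of_trivial]; exact hM.1
  obtain ⟨φ, hφ⟩ := hH.card_pos_eigenvalues_le_one_iff.1 (hM.2.2 hH)
  have hsymm : y ⬝ᵥ M *ᵥ x = x ⬝ᵥ M *ᵥ y := by
    rw [dotProduct_comm, dotProduct_mulVec, ← mulVec_transpose, hM.1.eq]
  have hφx : φ x ≠ 0 := fun h => hx.not_ge (hφ x h)
  have h := hφ (φ y • x - φ x • y) (by simp [mul_comm])
  simp only [mulVec_sub, mulVec_smul, sub_dotProduct, dotProduct_sub, smul_dotProduct,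
    dotProduct_smul, smul_eq_mul, hsymm] at h
  have hpos : 0 < φ x ^ 2 := by positivity
  by_contra! hlt
  have h1 := mul_pos hpos (sub_pos.2 hlt)
  nlinarith [mul_nonpos_of_nonneg_of_nonpos hx.le h,
    sq_nonneg (φ y * (x ⬝ᵥ M *ᵥ x) - φ x * (x ⬝ᵥ M *ᵥ y))]

theorem IsLorentzian.four_mul_mul_le_sq {n : ℕ} {M : Matrix (Fin n) (Fin n) ℝ}
    (hM : IsLorentzian M) (hpos : ∀ i j, 0 < M i j) (i j k l : Fin n) {a b c d : ℝ}
    (hab : a * b = 1) (hcd : c * d = 1) :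
    4 * (M i j * M k l) ≤
      (a * c * M i k + a * d * M i l + b * c * M j k + b * d * M j l) ^ 2 := by
  have hsym : ∀ i j, M j i = M i j := hM.1.apply
  have hB : ∀ (i j k l : Fin n) (a b c d : ℝ),
      (Pi.single i a + Pi.single j b) ⬝ᵥ M *ᵥ (Pi.single k c + Pi.single l d) =
        a * c * M i k + a * d * M i l + b * c * M j k + b * d * M j l := by
    intro i j k l a b c d
    simp [mulVec_add, add_dotProduct]
    ring
  have hQ : ∀ (i j : Fin n) {a b : ℝ}, a * b = 1 → 2 * M i j ≤
      (Pi.single i a + Pi.single j b) ⬝ᵥ M *ᵥ (Pi.single i a + Pi.single j b) := by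
    intro i j a b hab
    rw [hB, hsym i j, mul_comm b a, hab]
    linarith [mul_nonneg (mul_self_nonneg a) (hpos i i).le,
      mul_nonneg (mul_self_nonneg b) (hpos j j).le]
  have hij := hpos i j
  have hkl := hpos k l
  have hmain := hM.mul_le_sq (y := Pi.single k c + Pi.single l d)
    (lt_of_lt_of_le (by linarith) (hQ i j hab))
  have hprod := mul_le_mul (hQ i j hab) (hQ k l hcd) (by linarith)
    (le_trans (by linarith) (hQ i j hab))
  rw [hB i j k l] at hmain
  linarith

/-- A multiplicative four-point condition for positive Lorentzian matrices. -/
theorem IsLorentzian.four_point {n : ℕ} {M : Matrix (Fin n) (Fin n) ℝ} (hM : IsLorentzian M)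
    (hpos : ∀ i j, 0 < M i j) (i j k l : Fin n) :
    M i j * M k l ≤ 4 * max (M i k * M j l) (M i l * M j k) := by
  obtain ⟨p, ep⟩ : ∃ p, M i k = Real.exp p := ⟨_, (Real.exp_log (hpos _ _)).symm⟩
  obtain ⟨q, eq⟩ : ∃ p, M j l = Real.exp p := ⟨_, (Real.exp_log (hpos _ _)).symm⟩
  obtain ⟨r, er⟩ : ∃ p, M i l = Real.exp p := ⟨_, (Real.exp_log (hpos _ _)).symm⟩
  obtain ⟨s, es⟩ : ∃ p, M j k = Real.exp p := ⟨_, (Real.exp_log (hpos _ _)).symm⟩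
  have h := hM.four_mul_mul_le_sq hpos i j k l
    (a := Real.exp ((q + s - p - r) / 4)) (b := Real.exp (-((q + s - p - r) / 4)))
    (c := Real.exp ((q + r - p - s) / 4)) (d := Real.exp (-((q + r - p - s) / 4)))
    (by rw [← Real.exp_add]; simp) (by rw [← Real.exp_add]; simp)
  rw [ep, eq, er, es] at h ⊢
  simp only [← Real.exp_add] at h ⊢
  have e1 : (q + s - p - r) / 4 + (q + r - p - s) / 4 + p = (p + q) / 2 := by ring
  have e2 : (q + s - p - r) / 4 + -((q + r - p - s) / 4) + r = (r + s) / 2 := by ring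
  have e3 : -((q + s - p - r) / 4) + (q + r - p - s) / 4 + s = (r + s) / 2 := by ring
  have e4 : -((q + s - p - r) / 4) + -((q + r - p - s) / 4) + q = (p + q) / 2 := by ring
  rw [e1, e2, e3, e4] at h
  have h1 : Real.exp (p + q) = Real.exp ((p + q) / 2) ^ 2 := by
    rw [← Real.exp_nat_mul]; push_cast; ring_nf
  have h2 : Real.exp (r + s) = Real.exp ((r + s) / 2) ^ 2 := by
    rw [← Real.exp_nat_mul]; push_cast; ring_nf
  rw [h1, h2]
  nlinarith [sq_nonneg (Real.exp ((p + q) / 2) - Real.exp ((r + s) / 2)),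
    le_max_left (Real.exp ((p + q) / 2) ^ 2) (Real.exp ((r + s) / 2) ^ 2),
    le_max_right (Real.exp ((p + q) / 2) ^ 2) (Real.exp ((r + s) / 2) ^ 2)]

/-- An approximately ultrametric similarity is uniformly close to one satisfying the exact
ultrametric inequality through all midpoints in a given finite set. -/
theorem exists_ultrametric_approx {ι : Type*} [DecidableEq ι] {u : ι → ι → ℝ} {δ : ℝ}
    (hδ : 0 ≤ δ) (hsymm : ∀ i j, u i j = u j i)
    (hu : ∀ i j k, min (u i j) (u j k) ≤ u i k + δ) (S : Finset ι) :
    ∃ v : ι → ι → ℝ, (∀ i j, v i j = v j i) ∧ (∀ i j, u i j ≤ v i j) ∧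
      (∀ i j, v i j ≤ u i j + S.card * δ) ∧
      ∀ j ∈ S, ∀ i k, min (v i j) (v j k) ≤ v i k := by
  induction S using Finset.induction_on with
  | empty => exact ⟨u, hsymm, fun _ _ => le_rfl, by simp, by simp⟩
  | insert a S ha ih =>
    obtain ⟨w, hws, hlo, hhi, hw⟩ := ih
    refine ⟨fun i j => max (w i j) (min (w i a) (w a j)), fun i j => ?_,
      fun i j => (hlo i j).trans (le_max_left _ _), fun i j => ?_, fun j hj i k => ?_⟩
    · simp only [hws i j, hws a j, hws i a, min_comm (w a i)]
    · rw [Finset.card_insert_of_notMem ha]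
      push_cast
      have h1 := hhi i j
      have h2 : min (w i a) (w a j) ≤ min (u i a) (u a j) + S.card * δ := by
        rw [← min_add_add_right]
        exact min_le_min (hhi i a) (hhi a j)
      have h3 := hu i a j
      exact max_le (by linarith) (by linarith)
    · have key : ∀ t, t ≤ max (w i j) (min (w i a) (w a j)) →
          t ≤ max (w j k) (min (w j a) (w a k)) → t ≤ max (w i k) (min (w i a) (w a k)) := by
        intro t h1 h2
        have htr : ∀ b ∈ S, ∀ c d, t ≤ w c b → t ≤ w b d → t ≤ w c d :=
          fun b hb c d hc hd => (le_min hc hd).trans (hw b hb c d)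
        rw [le_max_iff, le_min_iff] at h1 h2 ⊢
        rcases Finset.mem_insert.1 hj with rfl | hj
        · tauto
        · have e1 := htr j hj i k
          have e2 := htr j hj i a
          have e3 := htr j hj a k
          tauto
      exact key _ (min_le_left _ _) (min_le_right _ _)

/-- If a weighting of pairs is nonpositive on all cuts, it is nonpositive on the sum of the cuts
given by the superlevel classes of an ultrametric similarity. -/
theorem sum_level_nonpos {ι : Type*} [Fintype ι] [DecidableEq ι] {P : Finset (ι × ι)}
    {α : ι × ι → ℝ}
    (hcut : ∀ S : Finset ι, ∑ q ∈ P, α q * ((if q.1 ∈ S then 1 else 0) +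
      (if q.2 ∈ S then 1 else 0) - 2 * (if q.1 ∈ S ∧ q.2 ∈ S then 1 else 0)) ≤ 0)
    {v : ι → ι → ℝ} (hsymm : ∀ i j, v i j = v j i)
    (hv : ∀ i j k, min (v i j) (v j k) ≤ v i k) (t : ℝ) :
    ∑ q ∈ P, α q * ((if t < v q.1 q.1 then 1 else 0) +
      (if t < v q.2 q.2 then 1 else 0) - 2 * (if t < v q.1 q.2 then 1 else 0)) ≤ 0 := by
  have htr : ∀ i j k, t < v i j → t < v j k → t < v i k :=
    fun i j k h1 h2 => (lt_min h1 h2).trans_le (hv i j k)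
  have hsm : ∀ i j, t < v i j → t < v j i := fun i j h => hsymm i j ▸ h
  set cls : ι → Finset ι := fun i => Finset.univ.filter fun j => t < v i j with hcls
  set T : Finset (Finset ι) :=
    (Finset.univ.filter fun i => t < v i i).image cls with hT
  have hcount : ∀ i j, ∑ C ∈ T, (if i ∈ C ∧ j ∈ C then (1 : ℝ) else 0) =
      if t < v i j then 1 else 0 := by
    intro i j
    have huniq : ∀ C ∈ T, i ∈ C → C = cls i := by
      intro C hC hi
      obtain ⟨k, -, rfl⟩ := Finset.mem_image.1 hC
      have hki : t < v k i := by simpa [hcls] using hi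
      ext l
      simp only [hcls, Finset.mem_filter, Finset.mem_univ, true_and]
      exact ⟨htr i k l (hsm k i hki), htr k i l hki⟩
    split_ifs with hij
    · have hii : t < v i i := htr i j i hij (hsm i j hij)
      have hmem : cls i ∈ T := Finset.mem_image.2 ⟨i, by simpa using hii, rfl⟩
      rw [Finset.sum_eq_single_of_mem (cls i) hmem]
      · simp [hcls, hii, hij]
      · intro C hC hne
        exact if_neg fun h => hne (huniq C hC h.1)
    · refine Finset.sum_eq_zero fun C hC => if_neg fun h => hij ?_
      have := h.2
      rw [huniq C hC h.1] at this
      simpa [hcls] using this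
  have hcount' : ∀ i, ∑ C ∈ T, (if i ∈ C then (1 : ℝ) else 0) = if t < v i i then 1 else 0 := by
    intro i
    simpa using hcount i i
  have hsum := Finset.sum_nonpos fun C (_ : C ∈ T) => hcut C
  rw [Finset.sum_comm] at hsum
  simpa only [← Finset.mul_sum, Finset.sum_sub_distrib, Finset.sum_add_distrib, hcount,
    hcount'] using hsum

theorem setIntegral_ite_lt {L R x : ℝ} (hL : L ≤ x) (hR : x ≤ R) :
    ∫ t in Set.Ioc L R, (if t < x then (1 : ℝ) else 0) = x - L := by
  have h : (fun t : ℝ => if t < x then (1 : ℝ) else 0) = (Set.Iio x).indicator 1 := by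
    ext t
    simp [Set.indicator_apply]
  have hI : Set.Iio x ∩ Set.Ioc L R = Set.Ioo L x := by
    ext t
    simp only [Set.mem_inter_iff, Set.mem_Iio, Set.mem_Ioc, Set.mem_Ioo]
    exact ⟨fun h => ⟨h.2.1, h.1⟩, fun h => ⟨h.2, h.1, h.2.le.trans hR⟩⟩
  rw [h, MeasureTheory.integral_indicator_one measurableSet_Iio,
    MeasureTheory.measureReal_restrict_apply measurableSet_Iio, hI, Real.volume_real_Ioo_of_le hL]

theorem integrableOn_ite_lt (L R x : ℝ) :
    MeasureTheory.IntegrableOn (fun t : ℝ => if t < x then (1 : ℝ) else 0) (Set.Ioc L R) := by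
  have h : (fun t : ℝ => if t < x then (1 : ℝ) else 0) = (Set.Iio x).indicator 1 := by
    ext t
    simp [Set.indicator_apply]
  rw [h]
  exact (MeasureTheory.integrable_const (1 : ℝ)).indicator measurableSet_Iio

/-- If a weighting of pairs is nonpositive on all cuts, it is nonpositive on the tree metric of
an ultrametric similarity. -/
theorem sum_tree_metric_nonpos {ι : Type*} [Fintype ι] [DecidableEq ι] {P : Finset (ι × ι)}
    {α : ι × ι → ℝ}
    (hcut : ∀ S : Finset ι, ∑ q ∈ P, α q * ((if q.1 ∈ S then 1 else 0) +
      (if q.2 ∈ S then 1 else 0) - 2 * (if q.1 ∈ S ∧ q.2 ∈ S then 1 else 0)) ≤ 0)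
    {v : ι → ι → ℝ} (hsymm : ∀ i j, v i j = v j i)
    (hv : ∀ i j k, min (v i j) (v j k) ≤ v i k) :
    ∑ q ∈ P, α q * (v q.1 q.1 + v q.2 q.2 - 2 * v q.1 q.2) ≤ 0 := by
  obtain ⟨L, hL⟩ := (Set.finite_range fun q : ι × ι => v q.1 q.2).bddBelow
  obtain ⟨R, hR⟩ := (Set.finite_range fun q : ι × ι => v q.1 q.2).bddAbove
  have hL' : ∀ i j, L ≤ v i j := fun i j => hL ⟨(i, j), rfl⟩
  have hR' : ∀ i j, v i j ≤ R := fun i j => hR ⟨(i, j), rfl⟩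
  have hint_ite : ∀ i j, MeasureTheory.IntegrableOn
    (fun t : ℝ => if t < v i j then (1 : ℝ) else 0) (Set.Ioc L R) :=
    fun i j => integrableOn_ite_lt L R (v i j)
  have h := MeasureTheory.integral_nonpos (μ := MeasureTheory.volume.restrict (Set.Ioc L R))
    fun t => sum_level_nonpos hcut hsymm hv t
  have hint_sum : ∀ q ∈ P, MeasureTheory.IntegrableOn (fun t : ℝ => α q *
      ((if t < v q.1 q.1 then 1 else 0) + (if t < v q.2 q.2 then 1 else 0) -
        2 * (if t < v q.1 q.2 then 1 else 0))) (Set.Ioc L R) := fun q _ =>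
    (((hint_ite _ _).add (hint_ite _ _)).sub ((hint_ite _ _).const_mul 2)).const_mul _
  rw [MeasureTheory.integral_finsetSum P hint_sum] at h
  refine le_trans (le_of_eq (Finset.sum_congr rfl fun q _ => ?_)) h
  rw [MeasureTheory.integral_const_mul,
    MeasureTheory.integral_sub (by exact (hint_ite _ _).add (hint_ite _ _))
      (by exact (hint_ite _ _).const_mul 2),
    MeasureTheory.integral_add (hint_ite _ _) (hint_ite _ _), MeasureTheory.integral_const_mul,
    setIntegral_ite_lt (hL' _ _) (hR' _ _), setIntegral_ite_lt (hL' _ _) (hR' _ _),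
    setIntegral_ite_lt (hL' _ _) (hR' _ _)]
  ring

/-- Test matrices of rank at most two attached to a cut. -/
theorem cut_matrix_isLorentzian {n : ℕ} (S : Finset (Fin n)) {p : ℝ} (hp : 1 ≤ p) :
    IsLorentzian (of fun i j : Fin n => if i ∈ S ↔ j ∈ S then 1 else p) ∧
      (of fun i j : Fin n => if i ∈ S ↔ j ∈ S then 1 else p).rank ≤ 2 := by
  set χ : Fin n → ℝ := fun i => if i ∈ S then 1 else 0 with hχ
  set M : Matrix (Fin n) (Fin n) ℝ := of fun i j => if i ∈ S ↔ j ∈ S then 1 else p with hM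
  have hdecomp : M = vecMulVec χ (χ + p • (1 - χ)) + vecMulVec (1 - χ) (p • χ + (1 - χ)) := by
    ext i j
    by_cases hi : i ∈ S <;> by_cases hj : j ∈ S <;> simp [hM, hχ, hi, hj, vecMulVec_apply]
  have hH : M.IsSymm := by
    ext i j
    simp [hM, iff_comm]
  refine ⟨⟨hH, fun i j => ?_, fun hM' => ?_⟩, ?_⟩
  · simp only [hM, of_apply]
    split_ifs <;> linarith
  · rw [hM'.card_pos_eigenvalues_le_one_iff]
    refine ⟨dotProductBilin ℝ ℝ 1, fun v hv => ?_⟩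
    have hv0 : 1 ⬝ᵥ v = 0 := hv
    rw [hdecomp]
    simp only [add_mulVec, vecMulVec_mulVec, add_dotProduct, smul_dotProduct, sub_dotProduct,
      hv0, dotProduct_comm v, smul_eq_mul, MulOpposite.smul_eq_mul_unop, MulOpposite.unop_op]
    nlinarith [sq_nonneg (χ ⬝ᵥ v)]
  · have hmul : M = (of ![χ, 1 - χ])ᵀ * of ![χ + p • (1 - χ), p • χ + (1 - χ)] := by
      rw [hdecomp]
      ext i j
      simp [mul_apply, vecMulVec_apply]
    rw [hmul]
    exact (rank_mul_le_left _ _).trans (rank_le_width _)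

/-- A product of powers bounded on the rank two cut matrices is nonpositive on every cut. -/
theorem sum_cut_nonpos_of_bounded {n : ℕ} {α : Fin n → Fin n → ℝ} {c : ℝ}
    (h : ∀ M : Matrix (Fin n) (Fin n) ℝ,
        IsLorentzian M → M.rank ≤ 2 → (∀ i, M i i = 1) → (∀ i j, 0 < M i j) →
        ∏ q ∈ offDiagPairs n, M q.1 q.2 ^ α q.1 q.2 ≤ c) (S : Finset (Fin n)) :
    ∑ q ∈ offDiagPairs n, α q.1 q.2 * ((if q.1 ∈ S then 1 else 0) +
      (if q.2 ∈ S then 1 else 0) - 2 * (if q.1 ∈ S ∧ q.2 ∈ S then 1 else 0)) ≤ 0 := by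
  set F := ∑ q ∈ offDiagPairs n, α q.1 q.2 * ((if q.1 ∈ S then 1 else 0) +
      (if q.2 ∈ S then 1 else 0) - 2 * (if q.1 ∈ S ∧ q.2 ∈ S then (1 : ℝ) else 0)) with hF
  have hbound : ∀ s : ℝ, 0 ≤ s → Real.exp (s * F) ≤ c := by
    intro s hs
    obtain ⟨hL, hr⟩ := cut_matrix_isLorentzian S (Real.one_le_exp hs)
    refine le_trans (le_of_eq ?_) (h _ hL hr (by simp) fun i j => ?_)
    · rw [hF, Finset.mul_sum, Real.exp_sum]
      refine Finset.prod_congr rfl fun q _ => ?_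
      by_cases h1 : q.1 ∈ S <;> by_cases h2 : q.2 ∈ S <;>
        simp [h1, h2, ← Real.exp_mul]
      norm_num
    · rw [of_apply]
      split_ifs
      exacts [one_pos, Real.exp_pos s]
  by_contra! hpos
  have h1 := hbound (|c| / F) (by positivity)
  rw [div_mul_cancel₀ _ hpos.ne'] at h1
  linarith [Real.add_one_le_exp |c|, le_abs_self c]

/-- A weighting of pairs that is nonpositive on every cut is bounded above on the logarithms of
normalized positive Lorentzian matrices. -/
theorem IsLorentzian.sum_mul_log_le {n : ℕ} {P : Finset (Fin n × Fin n)} {α : Fin n × Fin n → ℝ}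
    (hcut : ∀ S : Finset (Fin n), ∑ q ∈ P, α q * ((if q.1 ∈ S then 1 else 0) +
      (if q.2 ∈ S then 1 else 0) - 2 * (if q.1 ∈ S ∧ q.2 ∈ S then 1 else 0)) ≤ 0)
    {M : Matrix (Fin n) (Fin n) ℝ} (hM : IsLorentzian M) (hdiag : ∀ i, M i i = 1)
    (hpos : ∀ i j, 0 < M i j) (o : Fin n) :
    ∑ q ∈ P, α q * Real.log (M q.1 q.2) ≤ n * Real.log 4 * ∑ q ∈ P, |α q| := by
  have hδ : 0 ≤ Real.log 4 := Real.log_nonneg (by norm_num)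
  set l : Fin n → Fin n → ℝ := fun i j => Real.log (M i j) with hl
  have hls : ∀ i j, l i j = l j i := fun i j => by simp only [hl, hM.1.apply]
  have hld : ∀ i, l i i = 0 := fun i => by simp [hl, hdiag]
  have hfour : ∀ i j k m, l i j + l k m ≤ Real.log 4 + max (l i k + l j m) (l i m + l j k) := by
    intro i j k m
    have hmul : ∀ i j k m, Real.log (M i j * M k m) = l i j + l k m := fun i j k m =>
      Real.log_mul (hpos i j).ne' (hpos k m).ne'
    have h := hM.four_point hpos i j k m
    rw [mul_max_of_nonneg _ _ (by norm_num), le_max_iff] at h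
    rcases h with h | h
    all_goals
      have h' := Real.log_le_log (mul_pos (hpos _ _) (hpos _ _)) h
      rw [Real.log_mul four_ne_zero (mul_pos (hpos _ _) (hpos _ _)).ne', hmul, hmul] at h'
    · linarith [le_max_left (l i k + l j m) (l i m + l j k)]
    · linarith [le_max_right (l i k + l j m) (l i m + l j k)]
  obtain ⟨v, hvs, hlo, hhi, hv⟩ := exists_ultrametric_approx
    (u := fun i j => l o i + l o j - l i j) hδ (fun i j => by rw [hls i j]; ring)
    (fun i j k => by
      have h := hfour i k j o
      rw [hls i o, hls j o, hls k o, hls k j] at h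
      rcases le_max_iff.1 (sub_le_iff_le_add'.2 h) with h | h
      · exact (min_le_left _ _).trans (by linarith)
      · exact (min_le_right _ _).trans (by linarith)) Finset.univ
  have htree := sum_tree_metric_nonpos hcut hvs fun i j k => hv j (Finset.mem_univ j) i k
  have hterm : ∀ q ∈ P, 2 * (α q * l q.1 q.2) ≤
      α q * (v q.1 q.1 + v q.2 q.2 - 2 * v q.1 q.2) + 2 * (n * Real.log 4) * |α q| := by
    rintro ⟨i, j⟩ -
    have hbd : |2 * l i j - (v i i + v j j - 2 * v i j)| ≤ 2 * (n * Real.log 4) := by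
      simp only [Finset.card_univ, Fintype.card_fin] at hhi
      rw [abs_le]
      constructor <;>
        linarith [hlo i i, hlo j j, hlo i j, hhi i i, hhi j j, hhi i j, hld i, hld j]
    have h1 := le_abs_self (α (i, j) * (2 * l i j - (v i i + v j j - 2 * v i j)))
    rw [abs_mul] at h1
    have h2 := mul_le_mul_of_nonneg_left hbd (abs_nonneg (α (i, j)))
    dsimp only
    linarith
  have hsum := Finset.sum_le_sum hterm
  rw [Finset.sum_add_distrib, ← Finset.mul_sum, ← Finset.mul_sum] at hsum
  linarith

theorem reducedBR_eq_reducedBR_rank_two (n : ℕ) (hn : 0 < n) (α : Fin n → Fin n → ℝ) :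
    (∃ c : ℝ, 0 < c ∧ ∀ M : Matrix (Fin n) (Fin n) ℝ,
        IsLorentzian M → (∀ i, M i i = 1) → (∀ i j, 0 < M i j) →
        ∏ q ∈ offDiagPairs n, M q.1 q.2 ^ α q.1 q.2 ≤ c) ↔
    (∃ c' : ℝ, 0 < c' ∧ ∀ M : Matrix (Fin n) (Fin n) ℝ,
        IsLorentzian M → M.rank ≤ 2 → (∀ i, M i i = 1) → (∀ i j, 0 < M i j) →
        ∏ q ∈ offDiagPairs n, M q.1 q.2 ^ α q.1 q.2 ≤ c') := by
  constructor
  · rintro ⟨c, hc, h⟩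
    exact ⟨c, hc, fun M hM _ => h M hM⟩
  · rintro ⟨c, -, h⟩
    refine ⟨_, Real.exp_pos (n * Real.log 4 * ∑ q ∈ offDiagPairs n, |α q.1 q.2|),
      fun M hM hdiag hpos => ?_⟩
    have hle := hM.sum_mul_log_le (α := fun q => α q.1 q.2) (sum_cut_nonpos_of_bounded h)
      hdiag hpos ⟨0, hn⟩
    refine le_trans (le_of_eq ?_) (Real.exp_le_exp.2 hle)
    rw [Real.exp_sum]
    refine Finset.prod_congr rfl fun q _ => ?_
    rw [Real.rpow_def_of_pos (hpos _ _), mul_comm]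
end
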